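/- arXiv:0907.3295 — 2 statements merged into one kernel-verified Lean document; each statement's English description precedes it below -/
import Mathlib

section
/- Let E ⊆ H be precisely monotone and let ∂E denote the topological frontier of E. If a line L of H contains more than one point of ∂E, then L ⊆ ∂E. -/
open MeasureTheory Set Topology Filter

noncomputable section

/-- The Heisenberg group as a set: `ℝ³`. -/
abbrev Heis : Type := ℝ × ℝ × ℝ

/-- The Heisenberg group multiplication
`(a,b,c)·(a',b',c') = (a+a', b+b', c+c'+a·b')`. -/
def hMul (x y : Heis) : Heis :=
  (x.1 + y.1, x.2.1 + y.2.1, x.2.2 + y.2.2 + x.1 * y.2.1)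

/-- The abelianization homomorphism `π : H → ℝ²`, `π(a,b,c) = (a,b)`. -/
def hPi (x : Heis) : ℝ × ℝ := (x.1, x.2.1)

/-- The (horizontal) line of the Heisenberg group through `g` with direction `(a,b)`:
`{g·(ta, tb, t²ab/2) : t ∈ ℝ}`. -/
def hLine (g : Heis) (a b : ℝ) : Set Heis :=
  {p | ∃ t : ℝ, p = hMul g (t * a, t * b, t ^ 2 * a * b / 2)}

/-- A subset of the Heisenberg group is a (horizontal) line. -/
def IsLine (L : Set Heis) : Prop :=
  ∃ g : Heis, ∃ a b : ℝ, ¬(a = 0 ∧ b = 0) ∧ L = hLine g a b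

/-- Two lines of `H` are parallel if their `π`-images are parallel straight lines
in `ℝ²`, i.e. their direction vectors are linearly dependent. -/
def AreParallelLines (L₁ L₂ : Set Heis) : Prop :=
  ∃ g₁ g₂ : Heis, ∃ a₁ b₁ a₂ b₂ : ℝ,
    ¬(a₁ = 0 ∧ b₁ = 0) ∧ ¬(a₂ = 0 ∧ b₂ = 0) ∧
    L₁ = hLine g₁ a₁ b₁ ∧ L₂ = hLine g₂ a₂ b₂ ∧ a₁ * b₂ = a₂ * b₁

/-- Two lines of `H` are skew if they are disjoint and not parallel. -/
def AreSkewLines (L₁ L₂ : Set Heis) : Prop :=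
  IsLine L₁ ∧ IsLine L₂ ∧ Disjoint L₁ L₂ ∧ ¬ AreParallelLines L₁ L₂

/-- A subset `E` of the Heisenberg group is precisely monotone if every line
intersects both `E` and its complement in connected sets. -/
def IsPreciselyMonotone (E : Set Heis) : Prop :=
  ∀ L : Set Heis, IsLine L → IsPreconnected (L ∩ E) ∧ IsPreconnected (L ∩ Eᶜ)

/-- The point with parameter `t` on the horizontal line through `g` with direction `(a, b)`. -/
def hPoint (g : Heis) (a b t : ℝ) : Heis := hMul g (t * a, t * b, t ^ 2 * a * b / 2)

/-- The points of a precisely monotone set on a horizontal line form an interval. The direction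
may be zero, in which case the line is a single point. -/
theorem IsPreciselyMonotone.hPoint_mem {E : Set Heis} (hE : IsPreciselyMonotone E) (g : Heis)
    (a b : ℝ) {t₁ t₂ t₃ : ℝ} (h₁ : hPoint g a b t₁ ∈ E) (h₃ : hPoint g a b t₃ ∈ E)
    (h₂ : t₂ ∈ uIcc t₁ t₃) : hPoint g a b t₂ ∈ E := by
  by_cases hab : a = 0 ∧ b = 0
  · obtain ⟨rfl, rfl⟩ := hab
    simpa [hPoint] using h₁
  have hpos : 0 < a ^ 2 + b ^ 2 := by
    rcases not_and_or.mp hab with h | h <;> positivity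
  let φ : Heis → ℝ := fun p => (a * (p.1 - g.1) + b * (p.2.1 - g.2.1)) / (a ^ 2 + b ^ 2)
  have hφ : Continuous φ := by fun_prop
  have hφt (t : ℝ) : φ (hPoint g a b t) = t := by
    simp only [φ, hPoint, hMul]
    field_simp
    ring
  have hconn := ((hE (hLine g a b) ⟨g, a, b, hab, rfl⟩).1.image φ hφ.continuousOn).ordConnected
  have mem {t : ℝ} (h : hPoint g a b t ∈ E) : t ∈ φ '' (hLine g a b ∩ E) :=
    ⟨_, ⟨⟨t, rfl⟩, h⟩, hφt t⟩
  obtain ⟨p, ⟨⟨t, rfl⟩, hp⟩, ht⟩ := hconn.uIcc_subset (mem h₁) (mem h₃) h₂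
  have : t = t₂ := (hφt t).symm.trans ht
  exact this ▸ hp

theorem IsPreciselyMonotone.compl {E : Set Heis} (hE : IsPreciselyMonotone E) :
    IsPreciselyMonotone Eᶜ := fun L hL => by
  rw [compl_compl]
  exact (hE L hL).symm

/-- Given two points with parameters `0` and `1` on a horizontal line, nearby points `z.1`, `z.2`
can be joined to a common point near the point with parameter `c` by horizontal lines
that both pass through a prescribed neighbourhood of the point with parameter `τ`. -/
theorem eventually_exists_meeting_lines (x : Heis) {a b c τ : ℝ} (hab : ¬(a = 0 ∧ b = 0))
    (hc₀ : c ≠ 0) (hc₁ : c ≠ 1) {U : Set Heis} (hU : U ∈ 𝓝 (hPoint x a b τ)) :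
    ∀ᶠ z : Heis × Heis in 𝓝 (x, hPoint x a b 1), ∃ a₁ b₁ a₂ b₂ : ℝ,
      hPoint z.1 a₁ b₁ 1 = hPoint z.2 a₂ b₂ 1 ∧
      hPoint z.1 a₁ b₁ (τ / c) ∈ U ∧ hPoint z.2 a₂ b₂ ((τ - 1) / (c - 1)) ∈ U := by
  have hpos : 0 < a ^ 2 + b ^ 2 := by
    rcases not_and_or.mp hab with h | h <;> positivity
  have hc₁' : c - 1 ≠ 0 := sub_ne_zero.mpr hc₁
  let D : Heis × Heis → ℝ := fun z => (z.1.1 - z.2.1) ^ 2 + (z.1.2.1 - z.2.2.1) ^ 2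
  let N : Heis × Heis → ℝ := fun z =>
    (x.2.1 + c * b) * (z.1.1 - z.2.1) - (x.1 + c * a) * (z.1.2.1 - z.2.2.1)
      + 2 * (z.1.2.2 - z.2.2.2) - z.1.1 * z.1.2.1 + z.2.1 * z.2.2.1
  let V : Heis × Heis → ℝ := fun z => x.1 + c * a + N z / D z * (z.1.2.1 - z.2.2.1)
  let W : Heis × Heis → ℝ := fun z => x.2.1 + c * b - N z / D z * (z.1.1 - z.2.1)
  have hD₀ : D (x, hPoint x a b 1) = a ^ 2 + b ^ 2 := by
    simp only [D, hPoint, hMul]; ring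
  have hN₀ : N (x, hPoint x a b 1) = 0 := by
    simp only [N, hPoint, hMul]; ring
  have hV₀ : V (x, hPoint x a b 1) = x.1 + c * a := by simp [V, hN₀]
  have hW₀ : W (x, hPoint x a b 1) = x.2.1 + c * b := by simp [W, hN₀]
  have hD : Continuous D := by fun_prop
  have hN : Continuous N := by fun_prop
  have hND : ContinuousAt (fun z => N z / D z) (x, hPoint x a b 1) :=
    hN.continuousAt.div hD.continuousAt (by rw [hD₀]; exact hpos.ne')
  have hV : ContinuousAt V (x, hPoint x a b 1) := by fun_prop
  have hW : ContinuousAt W (x, hPoint x a b 1) := by fun_prop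
  have h₁ : ContinuousAt (fun z : Heis × Heis =>
      hPoint z.1 (V z - z.1.1) (W z - z.1.2.1) (τ / c)) (x, hPoint x a b 1) := by
    unfold hPoint hMul
    fun_prop
  have h₂ : ContinuousAt (fun z : Heis × Heis =>
      hPoint z.2 (V z - z.2.1) (W z - z.2.2.1) ((τ - 1) / (c - 1))) (x, hPoint x a b 1) := by
    unfold hPoint hMul
    fun_prop
  have hU₁ := h₁.preimage_mem_nhds (t := U) (by
    convert hU using 2
    simp only [hV₀, hW₀]
    simp only [hPoint, hMul, Prod.mk.injEq]
    refine ⟨?_, ?_, ?_⟩ <;> (field_simp; try ring))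
  have hU₂ := h₂.preimage_mem_nhds (t := U) (by
    convert hU using 2
    simp only [hV₀, hW₀]
    simp only [hPoint, hMul, Prod.mk.injEq]
    refine ⟨?_, ?_, ?_⟩ <;> (field_simp; try ring))
  have hD_ne : ∀ᶠ z in 𝓝 (x, hPoint x a b 1), D z ≠ 0 :=
    hD.continuousAt.eventually_ne (by rw [hD₀]; exact hpos.ne')
  filter_upwards [hU₁, hU₂, hD_ne] with z hz₁ hz₂ hz
  refine ⟨_, _, _, _, ?_, hz₁, hz₂⟩
  have key : W z * (z.1.1 - z.2.1) - V z * (z.1.2.1 - z.2.2.1)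
      + 2 * (z.1.2.2 - z.2.2.2) - z.1.1 * z.1.2.1 + z.2.1 * z.2.2.1 = 0 := by
    have h : N z / D z * D z = N z := div_mul_cancel₀ _ hz
    simp only [V, W]
    linear_combination -h
  simp only [hPoint, hMul, Prod.mk.injEq]
  refine ⟨by ring, by ring, ?_⟩
  linear_combination key / 2

/-- If the points with parameters `0` and `1` of a line lie in the frontier of `E`, then no point
with parameter `τ < 1` other than `0` lies in the interior of `E`. -/
theorem IsPreciselyMonotone.hPoint_notMem_interior_of_lt_one {E : Set Heis}
    (hE : IsPreciselyMonotone E) {x : Heis} {a b τ : ℝ} (hab : ¬(a = 0 ∧ b = 0))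
    (hx : x ∈ frontier E) (hy : hPoint x a b 1 ∈ frontier E) (hτ₀ : τ ≠ 0) (hτ₁ : τ < 1) :
    hPoint x a b τ ∉ interior E := by
  intro hr
  have hU : E ∈ 𝓝 (hPoint x a b τ) := mem_interior_iff_mem_nhds.mp hr
  rw [frontier_eq_closure_inter_closure] at hx hy
  have hzero (g : Heis) (a b : ℝ) : hPoint g a b 0 = g := by simp [hPoint, hMul]
  rcases hτ₀.lt_or_gt with hτ | hτ
  · have hmem : (x, hPoint x a b 1) ∈ closure (Eᶜ ×ˢ E) := by
      rw [closure_prod_eq]; exact ⟨hx.2, hy.1⟩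
    obtain ⟨⟨p, q⟩, ⟨hp, hq⟩, a₁, b₁, a₂, b₂, hv, hu₁, hu₂⟩ :=
      ((mem_closure_iff_frequently.mp hmem).and_eventually
        (eventually_exists_meeting_lines x (c := 1 / 2) hab (by norm_num) (by norm_num) hU)).exists
    have hvE : hPoint p a₁ b₁ 1 ∈ E := by
      rw [hv]
      refine hE.hPoint_mem q a₂ b₂ (t₁ := 0) (by rwa [hzero]) hu₂ (mem_uIcc_of_le zero_le_one ?_)
      rw [le_div_iff_of_neg (by norm_num)]
      linarith
    have := hE.hPoint_mem p a₁ b₁ (t₂ := 0) hvE hu₁ (mem_uIcc_of_ge (by linarith) (by linarith))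
    rw [hzero] at this
    exact hp this
  · have hmem : (x, hPoint x a b 1) ∈ closure (Eᶜ ×ˢ Eᶜ) := by
      rw [closure_prod_eq]; exact ⟨hx.2, hy.2⟩
    obtain ⟨⟨p, q⟩, ⟨hp, hq⟩, a₁, b₁, a₂, b₂, hv, hu₁, hu₂⟩ :=
      ((mem_closure_iff_frequently.mp hmem).and_eventually
        (eventually_exists_meeting_lines x (c := -1) hab (by norm_num) (by norm_num) hU)).exists
    by_cases hvE : hPoint p a₁ b₁ 1 ∈ E
    · have := hE.hPoint_mem p a₁ b₁ (t₂ := 0) hvE hu₁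
        (mem_uIcc_of_ge (by linarith) (by linarith))
      rw [hzero] at this
      exact hp this
    · rw [hv] at hvE
      exact hE.compl.hPoint_mem q a₂ b₂ (t₁ := 0) (by rwa [hzero]) hvE
        (mem_uIcc_of_le (div_nonneg_of_nonpos (by linarith) (by norm_num))
          (by rw [div_le_iff_of_neg (by norm_num)]; linarith)) hu₂

theorem IsPreciselyMonotone.hPoint_notMem_interior {E : Set Heis}
    (hE : IsPreciselyMonotone E) {x : Heis} {a b : ℝ} (hab : ¬(a = 0 ∧ b = 0))
    (hx : x ∈ frontier E) (hy : hPoint x a b 1 ∈ frontier E) (τ : ℝ) :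
    hPoint x a b τ ∉ interior E := by
  have hzero : hPoint x a b 0 = x := by simp [hPoint, hMul]
  have hfr {p : Heis} (hp : p ∈ frontier E) : p ∉ interior E := hp.2
  by_cases hτ₀ : τ = 0
  · rw [hτ₀, hzero]
    exact hfr hx
  rcases lt_trichotomy τ 1 with hτ | rfl | hτ
  · exact hE.hPoint_notMem_interior_of_lt_one hab hx hy hτ₀ hτ
  · exact hfr hy
  · have hrev (t : ℝ) : hPoint (hPoint x a b 1) (-a) (-b) (1 - t) = hPoint x a b t := by
      simp only [hPoint, hMul, Prod.mk.injEq]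
      refine ⟨?_, ?_, ?_⟩ <;> ring
    have hx' : hPoint (hPoint x a b 1) (-a) (-b) 1 ∈ frontier E := by
      have := hrev 0
      rw [sub_zero, hzero] at this
      rwa [this]
    rw [← hrev]
    exact hE.hPoint_notMem_interior_of_lt_one (by simpa using hab) hy hx'
      (by linarith) (by linarith)

/-- If `E ⊆ H` is precisely monotone and a line `L` contains two distinct points of
the topological frontier `∂E`, then `L ⊆ ∂E`. -/
theorem statement11 (E : Set Heis) (hE : IsPreciselyMonotone E)
    (L : Set Heis) (hL : IsLine L)
    (x y : Heis) (hx : x ∈ L ∩ frontier E) (hy : y ∈ L ∩ frontier E) (hxy : x ≠ y) :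
    L ⊆ frontier E := by
  obtain ⟨g, a, b, hab, rfl⟩ := hL
  obtain ⟨⟨s, rfl⟩, hx⟩ := hx
  obtain ⟨⟨t, rfl⟩, hy⟩ := hy
  rintro _ ⟨r, rfl⟩
  change hPoint g a b s ∈ frontier E at hx
  change hPoint g a b t ∈ frontier E at hy
  change hPoint g a b r ∈ frontier E
  have hst : t - s ≠ 0 := sub_ne_zero.mpr fun h => hxy (by rw [h])
  have hab' : ¬((t - s) * a = 0 ∧ (t - s) * b = 0) := by simpa [hst] using hab
  have hreparam (u : ℝ) :
      hPoint (hPoint g a b s) ((t - s) * a) ((t - s) * b) u = hPoint g a b (s + u * (t - s)) := by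
    simp only [hPoint, hMul, Prod.mk.injEq]
    refine ⟨?_, ?_, ?_⟩ <;> ring
  have hy' : hPoint (hPoint g a b s) ((t - s) * a) ((t - s) * b) 1 ∈ frontier E := by
    rw [hreparam]
    convert hy using 2
    ring
  have hr : hPoint (hPoint g a b s) ((t - s) * a) ((t - s) * b) ((r - s) / (t - s))
      = hPoint g a b r := by
    rw [hreparam, div_mul_cancel₀ _ hst, add_sub_cancel]
  have h₁ := hE.hPoint_notMem_interior hab' hx hy' ((r - s) / (t - s))
  rw [← frontier_compl] at hx hy'
  have h₂ := hE.compl.hPoint_notMem_interior hab' hx hy' ((r - s) / (t - s))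
  rw [hr] at h₁ h₂
  rw [interior_compl, notMem_compl_iff] at h₂
  exact ⟨h₂, h₁⟩
end
end

section
/- Suppose G ⊆ H has the property that every line of H which meets G in more than one point is contained in G. If G contains a pair of skew lines, or a pair of parallel lines L₁, L₂ with π(L₁) ≠ π(L₂), then G = H. -/
open MeasureTheory Set Topology Filter

noncomputable section

/-- A set in symmetric (exponential) coordinates on the Heisenberg group, where the horizontal
lines are affine lines, that contains every horizontal line meeting it in two points. -/
def SymClosed (S : Set Heis) : Prop :=
  ∀ x y z x' y' z' : ℝ, (x, y, z) ∈ S → (x', y', z') ∈ S → ¬(x = x' ∧ y = y') →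
    2 * (z' - z) = x * y' - x' * y → ∀ t : ℝ,
    (x + t * (x' - x), y + t * (y' - y), z + t * (z' - z)) ∈ S

/-- The point at time `t` of the horizontal line through `p` with direction `(a, b)`, in symmetric
coordinates. -/
def symLine (p : Heis) (a b t : ℝ) : Heis :=
  (p.1 + t * a, p.2.1 + t * b, p.2.2 + t * (p.1 * b - a * p.2.1) / 2)

/-- The affine frame with origin `p` and horizontal directions `(a, b)`, `(c, d)`, in symmetric
coordinates: a linear map of the plane followed by a left translation. -/
def symFrame (p : Heis) (a b c d : ℝ) (q : Heis) : Heis :=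
  (p.1 + (a * q.1 + c * q.2.1), p.2.1 + (b * q.1 + d * q.2.1),
    p.2.2 + (a * d - b * c) * q.2.2 +
      (p.1 * (b * q.1 + d * q.2.1) - p.2.1 * (a * q.1 + c * q.2.1)) / 2)

theorem symFrame_surjective (p : Heis) {a b c d : ℝ} (hD : a * d - b * c ≠ 0) :
    Function.Surjective (symFrame p a b c d) := by
  rintro ⟨x, y, z⟩
  obtain ⟨x₀, y₀, z₀⟩ := p
  refine ⟨(((x - x₀) * d - (y - y₀) * c) / (a * d - b * c),
    ((y - y₀) * a - (x - x₀) * b) / (a * d - b * c),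
    (z - z₀ - (x₀ * (y - y₀) - y₀ * (x - x₀)) / 2) / (a * d - b * c)), ?_⟩
  have h₁ : a * (((x - x₀) * d - (y - y₀) * c) / (a * d - b * c)) +
      c * (((y - y₀) * a - (x - x₀) * b) / (a * d - b * c)) = x - x₀ := by
    rw [mul_div_assoc', mul_div_assoc', ← add_div, div_eq_iff hD]
    ring
  have h₂ : b * (((x - x₀) * d - (y - y₀) * c) / (a * d - b * c)) +
      d * (((y - y₀) * a - (x - x₀) * b) / (a * d - b * c)) = y - y₀ := by
    rw [mul_div_assoc', mul_div_assoc', ← add_div, div_eq_iff hD]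
    ring
  simp only [symFrame, h₁, h₂, mul_div_cancel₀ _ hD, Prod.mk.injEq]
  refine ⟨by ring, by ring, by ring⟩

theorem SymClosed.preimage_symFrame {S : Set Heis} (hS : SymClosed S) (p : Heis) {a b c d : ℝ}
    (hD : a * d - b * c ≠ 0) : SymClosed (symFrame p a b c d ⁻¹' S) := by
  intro x y z x' y' z' h h' hne hz t
  have key := hS _ _ _ _ _ _ h h' ?_ ?_ t
  · rw [Set.mem_preimage]
    convert key using 1
    simp only [symFrame, Prod.mk.injEq]
    refine ⟨by ring, by ring, by ring⟩
  · rintro ⟨h₁, h₂⟩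
    simp only at h₁ h₂
    refine hne ⟨mul_left_cancel₀ hD ?_, mul_left_cancel₀ hD ?_⟩
    · linear_combination d * h₁ - c * h₂
    · linear_combination a * h₂ - b * h₁
  · simp only
    linear_combination (a * d - b * c) * hz

theorem SymClosed.eq_univ_of_standard_parallel {S : Set Heis} (hS : SymClosed S)
    (h₁ : ∀ s : ℝ, (s, 0, 0) ∈ S) (h₂ : ∀ s : ℝ, (s, 1, -s / 2) ∈ S) : S = univ := by
  have ruled : ∀ s t : ℝ, (s * (1 - 2 * t), t, t * s / 2) ∈ S := by
    intro s t
    convert hS _ _ _ _ _ _ (h₁ s) (h₂ (-s)) (by simp) (by ring) t using 1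
    simp only [Prod.mk.injEq]
    refine ⟨by ring, by ring, by ring⟩
  have join : ∀ t₁ t₂ x y z : ℝ, t₁ + t₂ = 2 * t₁ * t₂ → t₁ ≠ t₂ → y ≠ t₁ → y ≠ t₂ →
      (x, y, z) ∈ S := by
    intro t₁ t₂ x y z ht hne hy₁ hy₂
    have hd : t₂ - t₁ ≠ 0 := sub_ne_zero.2 hne.symm
    have hd₁ : y - t₁ ≠ 0 := sub_ne_zero.2 hy₁
    have hd₂ : t₂ - y ≠ 0 := sub_ne_zero.2 hy₂.symm
    set s₁ := (x * t₂ - 2 * z * (1 - 2 * t₂)) / (t₂ - y) with hs₁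
    set s₂ := (2 * z * (1 - 2 * t₁) - x * t₁) / (y - t₁) with hs₂
    have e₁ : s₁ * (t₂ - y) = x * t₂ - 2 * z * (1 - 2 * t₂) := div_mul_cancel₀ _ hd₂
    have e₂ : s₂ * (y - t₁) = 2 * z * (1 - 2 * t₁) - x * t₁ := div_mul_cancel₀ _ hd₁
    have hl : (y - t₁) / (t₂ - t₁) * (t₂ - t₁) = y - t₁ := div_mul_cancel₀ _ hd
    convert hS _ _ _ _ _ _ (ruled s₁ t₁) (ruled s₂ t₂) (fun h => hne h.2)
      (by linear_combination (s₂ - s₁) * ht) ((y - t₁) / (t₂ - t₁)) using 1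
    simp only [Prod.mk.injEq]
    refine ⟨mul_left_cancel₀ hd ?_, by linear_combination -hl, mul_left_cancel₀ hd ?_⟩
    · linear_combination -(1 - 2 * t₁) * e₁ - (1 - 2 * t₂) * e₂ -
        (s₂ * (1 - 2 * t₂) - s₁ * (1 - 2 * t₁)) * hl
    · linear_combination -(t₁ / 2) * e₁ - (t₂ / 2) * e₂ - (s₂ * t₂ - s₁ * t₁) / 2 * hl
  refine eq_univ_of_forall fun ⟨x, y, z⟩ => ?_
  by_cases hy : y = 2 ∨ y = 2 / 3
  · refine join 3 (3 / 5) x y z (by norm_num) (by norm_num) ?_ ?_ <;>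
      rcases hy with rfl | rfl <;> norm_num
  · push Not at hy
    exact join 2 (2 / 3) x y z (by norm_num) (by norm_num) hy.1 hy.2

theorem eq_univ_of_preimage_symFrame {S : Set Heis} {p : Heis} {a b c d : ℝ}
    (hD : a * d - b * c ≠ 0) (h : symFrame p a b c d ⁻¹' S = univ) : S = univ := by
  rw [← Set.image_preimage_eq S (symFrame_surjective p hD), h, Set.image_univ,
    (symFrame_surjective p hD).range_eq]

theorem SymClosed.eq_univ_of_parallel {S : Set Heis} (hS : SymClosed S) {p q : Heis} {a b : ℝ}
    (hp : ∀ t, symLine p a b t ∈ S) (hq : ∀ t, symLine q a b t ∈ S)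
    (hD : a * (q.2.1 - p.2.1) - b * (q.1 - p.1) ≠ 0) : S = univ := by
  obtain ⟨x₀, y₀, z₀⟩ := p
  obtain ⟨x₁, y₁, z₁⟩ := q
  simp only at hD
  obtain ⟨τ, hτ⟩ : ∃ τ, τ * (a * (y₁ - y₀) - b * (x₁ - x₀)) =
      2 * (z₁ - z₀) - x₀ * y₁ + x₁ * y₀ := ⟨_, div_mul_cancel₀ _ hD⟩
  have hD' : a * (y₁ + τ * b - y₀) - b * (x₁ + τ * a - x₀) ≠ 0 := by
    convert hD using 1
    ring
  refine eq_univ_of_preimage_symFrame (p := (x₀, y₀, z₀)) hD'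
    ((hS.preimage_symFrame _ hD').eq_univ_of_standard_parallel (fun s => ?_) fun s => ?_)
  · rw [Set.mem_preimage]
    convert hp s using 1
    simp only [symFrame, symLine, Prod.mk.injEq]
    refine ⟨by ring, by ring, by ring⟩
  · rw [Set.mem_preimage]
    convert hq (τ + s) using 1
    simp only [symFrame, symLine, Prod.mk.injEq]
    refine ⟨by ring, by ring, by linear_combination hτ / 2⟩

theorem SymClosed.eq_univ_of_standard_skew {S : Set Heis} (hS : SymClosed S) {k : ℝ} (hk : k ≠ 0)
    (h₁ : ∀ s : ℝ, (s, 0, 0) ∈ S) (h₂ : ∀ t : ℝ, (0, t, k) ∈ S) : S = univ := by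
  refine hS.eq_univ_of_parallel (p := (1, 0, 0)) (q := (-1, 0, 0)) (a := -1) (b := 2 * k)
    (fun t => ?_) (fun t => ?_) (by norm_num [hk])
  · convert hS _ _ _ _ _ _ (h₁ 1) (h₂ (2 * k)) (by simp) (by ring) t using 1
    simp only [symLine, Prod.mk.injEq]
    refine ⟨by ring, by ring, by ring⟩
  · convert hS _ _ _ _ _ _ (h₁ (-1)) (h₂ (-(2 * k))) (by simp) (by ring) (-t) using 1
    simp only [symLine, Prod.mk.injEq]
    refine ⟨by ring, by ring, by ring⟩

theorem SymClosed.eq_univ_of_skew {S : Set Heis} (hS : SymClosed S) {x y z z' a b c d : ℝ}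
    (hp : ∀ t, symLine (x, y, z) a b t ∈ S) (hq : ∀ t, symLine (x, y, z') c d t ∈ S)
    (hD : a * d - b * c ≠ 0) (hz : z ≠ z') : S = univ := by
  have hk : (z' - z) / (a * d - b * c) ≠ 0 := div_ne_zero (sub_ne_zero.2 hz.symm) hD
  refine eq_univ_of_preimage_symFrame (p := (x, y, z)) hD
    ((hS.preimage_symFrame _ hD).eq_univ_of_standard_skew hk (fun s => ?_) fun s => ?_)
  · rw [Set.mem_preimage]
    convert hp s using 1
    simp only [symFrame, symLine, Prod.mk.injEq]
    refine ⟨by ring, by ring, by ring⟩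
  · rw [Set.mem_preimage]
    convert hq s using 1
    simp only [symFrame, symLine, Prod.mk.injEq, mul_div_cancel₀ _ hD]
    refine ⟨by ring, by ring, by ring⟩

/-- The passage from symmetric coordinates to the matrix coordinates of `Heis`. -/
def ofSym (p : Heis) : Heis := (p.1, p.2.1, p.2.2 + p.1 * p.2.1 / 2)

/-- The passage from the matrix coordinates of `Heis` to symmetric coordinates. -/
def toSym (p : Heis) : Heis := (p.1, p.2.1, p.2.2 - p.1 * p.2.1 / 2)

theorem ofSym_symLine_toSym (g : Heis) (a b t : ℝ) :
    ofSym (symLine (toSym g) a b t) = hMul g (t * a, t * b, t ^ 2 * a * b / 2) := by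
  simp only [ofSym, toSym, symLine, hMul, Prod.mk.injEq]
  refine ⟨trivial, trivial, by ring⟩

theorem ofSym_symLine_toSym_mem (g : Heis) (a b t : ℝ) :
    ofSym (symLine (toSym g) a b t) ∈ hLine g a b :=
  ⟨t, ofSym_symLine_toSym g a b t⟩

theorem ofSym_toSym (p : Heis) : ofSym (toSym p) = p := by
  simp [ofSym, toSym]

theorem toSym_ofSym (p : Heis) : toSym (ofSym p) = p := by
  simp [ofSym, toSym]

theorem symClosed_preimage_ofSym {G : Set Heis}
    (hG : ∀ L : Set Heis, IsLine L → (∃ x ∈ L ∩ G, ∃ y ∈ L ∩ G, x ≠ y) → L ⊆ G) :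
    SymClosed (ofSym ⁻¹' G) := by
  intro x y z x' y' z' h h' hne hz t
  have mem : ∀ t, ofSym (x + t * (x' - x), y + t * (y' - y), z + t * (z' - z)) ∈
      hLine (ofSym (x, y, z)) (x' - x) (y' - y) := by
    intro t
    convert ofSym_symLine_toSym_mem (ofSym (x, y, z)) (x' - x) (y' - y) t using 2
    simp only [toSym_ofSym, symLine, Prod.mk.injEq]
    refine ⟨trivial, trivial, by linear_combination t / 2 * hz⟩
  have hdir : ¬(x' - x = 0 ∧ y' - y = 0) := fun hd =>
    hne ⟨(sub_eq_zero.1 hd.1).symm, (sub_eq_zero.1 hd.2).symm⟩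
  refine hG _ ⟨_, _, _, hdir, rfl⟩
    ⟨ofSym (x, y, z), ⟨?_, h⟩, ofSym (x', y', z'), ⟨?_, h'⟩, ?_⟩ (mem t)
  · simpa using mem 0
  · simpa using mem 1
  · intro he
    simp only [ofSym, Prod.mk.injEq] at he
    exact hne ⟨he.1, he.2.1⟩

theorem symLine_symLine (p : Heis) (a b s t : ℝ) :
    symLine (symLine p a b s) a b t = symLine p a b (s + t) := by
  simp only [symLine, Prod.mk.injEq]
  refine ⟨by ring, by ring, by ring⟩

theorem symLine_smul (p : Heis) (a b k t : ℝ) :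
    symLine p (k * a) (k * b) t = symLine p a b (t * k) := by
  simp only [symLine, Prod.mk.injEq]
  refine ⟨by ring, by ring, by ring⟩

theorem exists_smul_of_cross_eq_zero {a b c d : ℝ} (hab : ¬(a = 0 ∧ b = 0))
    (h : a * d = c * b) : ∃ k, c = k * a ∧ d = k * b := by
  by_cases ha : a = 0
  · have hb : b ≠ 0 := fun hb => hab ⟨ha, hb⟩
    refine ⟨d / b, ?_, (div_mul_cancel₀ _ hb).symm⟩
    subst ha
    simpa [hb] using h.symm
  · refine ⟨c / a, (div_mul_cancel₀ _ ha).symm, ?_⟩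
    field_simp
    linear_combination h

theorem image_hPi_hLine_subset {g g' : Heis} {a b k : ℝ} (hab : ¬(a = 0 ∧ b = 0))
    (hk : k ≠ 0) (h : a * (g'.2.1 - g.2.1) - b * (g'.1 - g.1) = 0) (l : ℝ) :
    hPi '' hLine g (l * a) (l * b) ⊆ hPi '' hLine g' (k * a) (k * b) := by
  obtain ⟨r, hr₁, hr₂⟩ := exists_smul_of_cross_eq_zero (c := g'.1 - g.1)
    (d := g'.2.1 - g.2.1) hab (by linear_combination h)
  rintro _ ⟨_, ⟨t, rfl⟩, rfl⟩
  refine ⟨_, ⟨(t * l - r) / k, rfl⟩, ?_⟩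
  have hc : (t * l - r) / k * k = t * l - r := div_mul_cancel₀ _ hk
  simp only [hPi, hMul, Prod.mk.injEq]
  constructor
  · linear_combination a * hc + hr₁
  · linear_combination b * hc + hr₂

/-- If `G ⊆ H` contains every line meeting it in more than one point, and `G` contains
a pair of skew lines or a pair of parallel lines with distinct projections, then
`G = H`. -/
theorem statement13 (G : Set Heis)
    (hG : ∀ L : Set Heis, IsLine L →
      (∃ x ∈ L ∩ G, ∃ y ∈ L ∩ G, x ≠ y) → L ⊆ G)
    (h : (∃ L₁ L₂ : Set Heis, AreSkewLines L₁ L₂ ∧ L₁ ⊆ G ∧ L₂ ⊆ G) ∨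
         (∃ L₁ L₂ : Set Heis, AreParallelLines L₁ L₂ ∧ hPi '' L₁ ≠ hPi '' L₂ ∧
            L₁ ⊆ G ∧ L₂ ⊆ G)) :
    G = Set.univ := by
  have hS := symClosed_preimage_ofSym hG
  suffices hu : ofSym ⁻¹' G = univ by
    refine eq_univ_of_forall fun p => ?_
    have hp : toSym p ∈ ofSym ⁻¹' G := hu ▸ mem_univ _
    rwa [Set.mem_preimage, ofSym_toSym] at hp
  rcases h with ⟨_, _, ⟨⟨g, a, b, hab, rfl⟩, ⟨g', c, d, hcd, rfl⟩, hdis, hpar⟩, hL, hL'⟩ |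
    ⟨_, _, ⟨g, g', a, b, c, d, hab, hcd, rfl, rfl, hpar⟩, hne, hL, hL'⟩
  · have hD : a * d - b * c ≠ 0 := fun h =>
      hpar ⟨g, g', a, b, c, d, hab, hcd, rfl, rfl, by linear_combination h⟩
    obtain ⟨s, hs⟩ : ∃ s, s * (a * d - b * c) = (g'.1 - g.1) * d - (g'.2.1 - g.2.1) * c :=
      ⟨_, div_mul_cancel₀ _ hD⟩
    obtain ⟨t, ht⟩ : ∃ t, t * (a * d - b * c) = (g'.1 - g.1) * b - (g'.2.1 - g.2.1) * a :=
      ⟨_, div_mul_cancel₀ _ hD⟩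
    have hx : g'.1 + t * c = g.1 + s * a :=
      mul_left_cancel₀ hD (by linear_combination c * ht - a * hs)
    have hy : g'.2.1 + t * d = g.2.1 + s * b :=
      mul_left_cancel₀ hD (by linear_combination d * ht - b * hs)
    have hp : ∀ r, symLine (symLine (toSym g) a b s) a b r ∈ ofSym ⁻¹' G := fun r => by
      rw [symLine_symLine]
      exact hL (ofSym_symLine_toSym_mem g a b _)
    have hq : ∀ r, symLine (symLine (toSym g') c d t) c d r ∈ ofSym ⁻¹' G := fun r => by
      rw [symLine_symLine]
      exact hL' (ofSym_symLine_toSym_mem g' c d _)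
    have hq₀ : symLine (toSym g') c d t =
        (g.1 + s * a, g.2.1 + s * b, (symLine (toSym g') c d t).2.2) := by
      rw [← hx, ← hy]
      rfl
    rw [hq₀] at hq
    refine hS.eq_univ_of_skew hp hq hD fun hz => ?_
    refine Set.disjoint_left.1 hdis (ofSym_symLine_toSym_mem g a b s) ?_
    convert ofSym_symLine_toSym_mem g' c d t using 2
    rw [hq₀, ← hz]
    rfl
  · obtain ⟨k, rfl, rfl⟩ := exists_smul_of_cross_eq_zero hab hpar
    have hk : k ≠ 0 := by
      rintro rfl
      simp at hcd
    refine hS.eq_univ_of_parallel (p := toSym g) (q := toSym g') (a := a) (b := b)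
      (fun t => hL (ofSym_symLine_toSym_mem g a b t)) (fun t => ?_) fun h => hne ?_
    · have := ofSym_symLine_toSym_mem g' (k * a) (k * b) (t / k)
      rw [symLine_smul, div_mul_cancel₀ _ hk] at this
      exact hL' this
    · simp only [toSym] at h
      refine Subset.antisymm ?_ ?_
      · simpa using image_hPi_hLine_subset hab hk h 1
      · simpa using image_hPi_hLine_subset (g := g') (g' := g) hab one_ne_zero
          (by linear_combination -h) k
end
end
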